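/- Let X be a compact Hausdorff space and Y ⊆ X a closed subset. The following conditions are equivalent: (a) the quotient module C(X,ℂ)/I_Y is flat as a C(X,ℂ)-module; (b) for every f ∈ I_Y one has I_Y + Ann(f) = C(X,ℂ), where Ann(f) = {g ∈ C(X,ℂ) : g·f = 0}; (c) every f ∈ C(X,ℂ) vanishing on Y vanishes on some open neighborhood of Y. -/

import Mathlib

/-- The ideal of continuous functions vanishing on the subset `Y`. -/
noncomputable def IY {X : Type*} [TopologicalSpace X] (Y : Set X) : Ideal C(X, ℂ) where
  carrier := {f : C(X, ℂ) | ∀ y ∈ Y, f y = 0}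
  add_mem' := by
    intro a b ha hb y hy
    simp [ha y hy, hb y hy]
  zero_mem' := by
    intro y hy
    simp
  smul_mem' := by
    intro c f hf y hy
    simp [hf y hy]

/-- The annihilator ideal of a single continuous function `f`. -/
noncomputable def AnnI {X : Type*} [TopologicalSpace X] (f : C(X, ℂ)) : Ideal C(X, ℂ) where
  carrier := {g : C(X, ℂ) | g * f = 0}
  add_mem' := by
    intro a b ha hb
    simp only [Set.mem_setOf_eq] at *
    rw [add_mul, ha, hb, add_zero]
  zero_mem' := by
    simp
  smul_mem' := by
    intro c g hg
    simp only [Set.mem_setOf_eq, smul_eq_mul] at *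
    rw [mul_assoc, hg, mul_zero]

/-- A quotient `R ⧸ I` is flat iff every element of `I` is fixed by multiplication by
some element of `I`. -/
theorem Ideal.flat_quotient_iff_forall_exists_mul_eq {R : Type*} [CommRing R] (I : Ideal R) :
    Module.Flat R (R ⧸ I) ↔ ∀ f ∈ I, ∃ e ∈ I, e * f = f := by
  constructor
  · intro _ f hf
    have h : ∑ _i : Unit, f • (Ideal.Quotient.mk I 1) = 0 := by
      rw [Fintype.sum_unique, ← Ideal.Quotient.mk_eq_mk, ← Submodule.Quotient.mk_smul,
        Submodule.Quotient.mk_eq_zero]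
      simpa using hf
    obtain ⟨k, a, y, hy, ha⟩ := Module.Flat.isTrivialRelation_of_sum_smul_eq_zero h
    choose r hr using fun j ↦ Ideal.Quotient.mk_surjective (y j)
    refine ⟨1 - ∑ j, a () j * r j, ?_, ?_⟩
    · refine (Ideal.Quotient.mk_eq_mk_iff_sub_mem _ _).mp ((hy ()).trans ?_)
      simp [← hr, Algebra.smul_def]
    · have ha' : ∀ j, f * a () j = 0 := fun j ↦ by simpa using ha j
      have hsum : (∑ j, a () j * r j) * f = 0 := by
        rw [Finset.sum_mul]
        exact Finset.sum_eq_zero fun j _ ↦ by linear_combination r j * ha' j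
      rw [sub_mul, hsum, one_mul, sub_zero]
  · intro h
    refine Module.Flat.of_forall_isTrivialRelation fun {l f x} hfx ↦ ?_
    choose r hr using fun i ↦ Ideal.Quotient.mk_surjective (x i)
    have hmem : ∑ i, f i * r i ∈ I := by
      rw [← Ideal.Quotient.eq_zero_iff_mem, ← hfx]
      simp [← hr, Algebra.smul_def]
    obtain ⟨e, he, hef⟩ := h _ hmem
    refine ⟨1, fun i _ ↦ (1 - e) * r i, fun _ ↦ 1, fun i ↦ ?_, fun _ ↦ ?_⟩
    · simp [← hr, Algebra.smul_def, Ideal.Quotient.eq_zero_iff_mem.mpr he]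
    · calc ∑ i, f i * ((1 - e) * r i) = (1 - e) * ∑ i, f i * r i := by
            rw [Finset.mul_sum]
            exact Finset.sum_congr rfl fun i _ ↦ by ring
        _ = 0 := by rw [sub_mul, hef, one_mul, sub_self]

theorem sup_AnnI_eq_top_iff {X : Type*} [TopologicalSpace X] (I : Ideal C(X, ℂ)) (f : C(X, ℂ)) :
    I ⊔ AnnI f = ⊤ ↔ ∃ e ∈ I, e * f = f := by
  rw [Ideal.eq_top_iff_one, Submodule.mem_sup]
  constructor
  · rintro ⟨e, he, g, hg, heg⟩
    have hg' : g * f = 0 := hg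
    exact ⟨e, he, by linear_combination f * heg - hg'⟩
  · rintro ⟨e, he, hef⟩
    refine ⟨e, he, 1 - e, ?_, by ring⟩
    change (1 - e) * f = 0
    rw [sub_mul, hef, one_mul, sub_self]

theorem exists_mem_IY_mul_eq_iff {X : Type*} [TopologicalSpace X] [NormalSpace X] {Y : Set X}
    (hY : IsClosed Y) (f : C(X, ℂ)) :
    (∃ e ∈ IY Y, e * f = f) ↔ ∃ U : Set X, IsOpen U ∧ Y ⊆ U ∧ ∀ x ∈ U, f x = 0 := by
  constructor
  · rintro ⟨e, he, hef⟩
    refine ⟨{x | e x ≠ 1}, isOpen_ne_fun e.continuous continuous_const, fun y hy ↦ ?_,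
      fun x hx ↦ ?_⟩
    · simp [he y hy]
    · by_contra hfx
      exact hx (mul_right_cancel₀ hfx (by simpa using DFunLike.congr_fun hef x))
  · rintro ⟨U, hU, hYU, hfU⟩
    obtain ⟨u, hu0, hu1, -⟩ := exists_continuous_zero_one_of_isClosed hY hU.isClosed_compl
      (Set.disjoint_compl_right_iff_subset.mpr hYU)
    refine ⟨⟨fun x ↦ (u x : ℂ), by fun_prop⟩, fun y hy ↦ ?_, ?_⟩
    · simp [hu0 hy]
    · ext x
      by_cases hx : x ∈ U
      · simp [hfU x hx]
      · simp [hu1 (show x ∈ Uᶜ from hx)]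

/-- For a closed subset `Y` of a compact Hausdorff space `X`, the following are
equivalent: (a) `C(X,ℂ)/I_Y` is a flat `C(X,ℂ)`-module; (b) `I_Y + Ann(f) = C(X,ℂ)`
for every `f ∈ I_Y`; (c) every continuous function vanishing on `Y` vanishes on an
open neighborhood of `Y`. -/
theorem stmt6 {X : Type*} [TopologicalSpace X] [CompactSpace X] [T2Space X]
    (Y : Set X) (hY : IsClosed Y) :
    (Module.Flat C(X, ℂ) (C(X, ℂ) ⧸ IY Y) ↔ ∀ f ∈ IY Y, IY Y ⊔ AnnI f = ⊤) ∧
    ((∀ f ∈ IY Y, IY Y ⊔ AnnI f = ⊤) ↔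
      ∀ f : C(X, ℂ), (∀ y ∈ Y, f y = 0) →
        ∃ U : Set X, IsOpen U ∧ Y ⊆ U ∧ ∀ x ∈ U, f x = 0) := by
  simp only [Ideal.flat_quotient_iff_forall_exists_mul_eq, sup_AnnI_eq_top_iff, true_and]
  exact forall₂_congr fun f _ ↦ exists_mem_IY_mul_eq_iff hY f
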